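/- Let G be a complete tripartite graph on n vertices with partition classes V₁, V₂, V₃ of sizes n₁ ≥ n₂ ≥ n₃, whose edges are coloured red and blue, and suppose n₁ = n/2. Then there exist a red path R and a blue path B in G whose vertex sets intersect in exactly one vertex x, which is an endvertex of both R and B, and such that V(R) ∪ V(B) = V(G). -/

import Mathlib

open SimpleGraph Set

/- Convention: colour `true` is red, colour `false` is blue. -/

/-- The subgraph of `G` consisting of the edges of colour `b`. -/
def monoSubgraph {V : Type*} (G : SimpleGraph V) (c : Sym2 V → Bool) (b : Bool) :
    SimpleGraph V :=
  SimpleGraph.fromEdgeSet {e | e ∈ G.edgeSet ∧ c e = b}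

/-- `S` is the vertex set of a (possibly empty, possibly trivial) path of `G`
all of whose edges have colour `b`. -/
def IsMonoPathSet {V : Type*} (G : SimpleGraph V) (c : Sym2 V → Bool) (b : Bool)
    (S : Set V) : Prop :=
  S = ∅ ∨ ∃ (u v : V) (p : G.Walk u v), p.IsPath ∧ (∀ e ∈ p.edges, c e = b) ∧
    S = {x | x ∈ p.support}

/-- `S` is the vertex set of a (possibly degenerate: empty, single vertex or single edge)
cycle of `G` all of whose edges have colour `b`. -/
def IsMonoCycleSet {V : Type*} (G : SimpleGraph V) (c : Sym2 V → Bool) (b : Bool)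
    (S : Set V) : Prop :=
  S = ∅ ∨ (∃ v, S = {v}) ∨ (∃ u v, G.Adj u v ∧ c s(u, v) = b ∧ S = {u, v}) ∨
    ∃ (v : V) (p : G.Walk v v), p.IsCycle ∧ (∀ e ∈ p.edges, c e = b) ∧
      S = {x | x ∈ p.support}

/-- `M` is a matching of `G` in colour `b` which is connected, i.e. all its edges lie in one
connected component of the subgraph formed by the edges of colour `b`. -/
def IsConnMatching {V : Type*} (G : SimpleGraph V) (c : Sym2 V → Bool) (b : Bool)
    (M : Set (Sym2 V)) : Prop :=
  (∀ e ∈ M, e ∈ G.edgeSet ∧ c e = b) ∧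
  (∀ e ∈ M, ∀ f ∈ M, e ≠ f → ∀ x, x ∈ e → x ∉ f) ∧
  (∀ e ∈ M, ∀ f ∈ M, ∀ x, x ∈ e → ∀ y, y ∈ f → (monoSubgraph G c b).Reachable x y)

/-- The set of vertices covered by a set of edges. -/
def matchSupport {V : Type*} (M : Set (Sym2 V)) : Set V := {x | ∃ e ∈ M, x ∈ e}

/-- The colouring `c` of the (bipartite, with classes `U` and `W`) graph `G` is a split
colouring: `U = A ∪ B`, `W = C ∪ D`, the edges between `A,C` and between `B,D` are blue
(`false`), and the edges between `A,D` and between `B,C` are red (`true`). -/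
def IsSplitColouring {V : Type*} (G : SimpleGraph V) (c : Sym2 V → Bool)
    (U W : Set V) : Prop :=
  ∃ A B C D : Set V,
    A ∪ B = U ∧ Disjoint A B ∧ C ∪ D = W ∧ Disjoint C D ∧
    (∀ u v, G.Adj u v →
      (((u ∈ A ∧ v ∈ C) ∨ (u ∈ C ∧ v ∈ A) ∨ (u ∈ B ∧ v ∈ D) ∨ (u ∈ D ∧ v ∈ B)) →
        c s(u, v) = false)) ∧
    (∀ u v, G.Adj u v →
      (((u ∈ A ∧ v ∈ D) ∨ (u ∈ D ∧ v ∈ A) ∨ (u ∈ B ∧ v ∈ C) ∨ (u ∈ C ∧ v ∈ B)) →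
        c s(u, v) = true))

/-- The colouring `c` of `G` is `δ`-close to a split colouring: one can delete at most
`δ|E(G)|` edges so that the remaining graph is bipartite and the colouring on it is a
split colouring. -/
def CloseToSplit {V : Type*} (G : SimpleGraph V) (c : Sym2 V → Bool) (δ : ℝ) : Prop :=
  ∃ F : Set (Sym2 V), F ⊆ G.edgeSet ∧ (F.ncard : ℝ) ≤ δ * (G.edgeSet.ncard : ℝ) ∧
    ∃ U W : Set V, U ∪ W = Set.univ ∧ Disjoint U W ∧
      (∀ u v, (G.deleteEdges F).Adj u v → ((u ∈ U ∧ v ∈ W) ∨ (u ∈ W ∧ v ∈ U))) ∧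
      IsSplitColouring (G.deleteEdges F) c U W

/-- `l` is a nonempty list, consecutive elements of which are related by `R`, that starts at `u`
and ends at `v`. -/
def IsListPath {V : Type*} (R : V → V → Prop) (u v : V) (l : List V) : Prop :=
  l.IsChain R ∧ l.head? = some u ∧ l.getLast? = some v

namespace IsListPath

variable {V : Type*} {R : V → V → Prop} {u v w z : V} {l m : List V}

theorem single (u : V) : IsListPath R u u [u] := by simp [IsListPath]

theorem append (h : IsListPath R u v l) (hvw : R v w) (h' : IsListPath R w z m) :
    IsListPath R u z (l ++ m) := by
  obtain ⟨h1, h2, h3⟩ := h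
  obtain ⟨h4, h5, h6⟩ := h'
  refine ⟨List.isChain_append.2 ⟨h1, h4, ?_⟩, by simp [h2], by simp [h6]⟩
  intro x hx y hy
  rw [h3] at hx
  rw [h5] at hy
  cases hx
  cases hy
  exact hvw

theorem cons (huw : R u w) (h : IsListPath R w z m) : IsListPath R u z (u :: m) :=
  (single u).append huw h

theorem reverse (hR : ∀ a b, R a b → R b a) (h : IsListPath R u v l) :
    IsListPath R v u l.reverse := by
  obtain ⟨h1, h2, h3⟩ := h
  refine ⟨List.isChain_reverse.2 (h1.imp fun a b => hR a b), by simp [h3], by simp [h2]⟩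

theorem ne_nil (h : IsListPath R u v l) : l ≠ [] := by
  rintro rfl
  simp [IsListPath] at h

theorem of_isChain (h : l.IsChain R) (hl : l ≠ []) : ∃ u v, IsListPath R u v l :=
  ⟨l.head hl, l.getLast hl, h, List.head?_eq_some_head hl, List.getLast?_eq_some_getLast hl⟩

theorem eq_cons (h : IsListPath R u v l) :
    (u = v ∧ l = [u]) ∨ ∃ w m, l = u :: m ∧ R u w ∧ IsListPath R w v m := by
  obtain ⟨h1, h2, h3⟩ := h
  match l with
  | [] => simp at h2
  | [a] =>
    left
    simp_all
  | a :: b :: m =>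
    right
    simp only [List.head?_cons, Option.some.injEq] at h2
    subst h2
    rw [List.isChain_cons_cons] at h1
    exact ⟨b, b :: m, rfl, h1.1, h1.2, rfl, by simpa using h3⟩

theorem class_eq_iff {cls : V → Bool} (hR : ∀ a b, R a b → cls a ≠ cls b)
    (h : IsListPath R u v l) : cls u = cls v ↔ ¬ Even l.length := by
  induction l generalizing u with
  | nil => exact absurd rfl h.ne_nil
  | cons a m ih =>
    rcases h.eq_cons with ⟨rfl, h'⟩ | ⟨w, m', h, huw, hp⟩
    · simp [h']
    · simp only [List.cons.injEq] at h
      obtain ⟨rfl, rfl⟩ := h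
      have := ih hp
      have h2 := hR _ _ huw
      rw [List.length_cons, Nat.even_add_one, ← this]
      revert h2
      cases cls a <;> cases cls w <;> cases cls v <;> simp

end IsListPath

/-- Interleaves two lists. -/
def interleave {V : Type*} : List V → List V → List V
  | [], b => b
  | x :: a, b => x :: interleave b a
termination_by a b => a.length + b.length

theorem count_interleave {V : Type*} [DecidableEq V] (v : V) (a b : List V) :
    (interleave a b).count v = a.count v + b.count v := by
  induction a, b using interleave.induct with
  | case1 b => simp [interleave]
  | case2 b x a ih => simp [interleave, List.count_cons, ih]; omega

theorem isListPath_interleave {V : Type*} {B : V → V → Prop} (hB : ∀ a b, B a b → B b a)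
    (x : V) (a b : List V) (h1 : b.length ≤ a.length + 1) (h2 : a.length ≤ b.length)
    (h : ∀ s ∈ x :: a, ∀ t ∈ b, B s t) :
    ∃ z, IsListPath B x z (interleave (x :: a) b) ∧
      (a.length = b.length → z ∈ x :: a) ∧ (b.length = a.length + 1 → z ∈ b) := by
  induction a generalizing x b with
  | nil =>
    match b, h1 with
    | [], _ => exact ⟨x, by simp [interleave, IsListPath], by simp, by simp⟩
    | [y], _ =>
      refine ⟨y, ?_, by simp, by simp⟩
      simp only [interleave]
      exact .cons (h x (by simp) y (by simp)) (.single y)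
  | cons x' a ih =>
    match b, h2 with
    | y :: b, h2 =>
      simp only [List.length_cons] at h1 h2
      obtain ⟨z, hz, hz1, hz2⟩ := ih x' b (by omega) (by omega)
        (fun s hs t ht => h s (by simp at hs ⊢; tauto) t (by simp [ht]))
      refine ⟨z, ?_, ?_, ?_⟩
      · rw [interleave, interleave]
        exact .cons (h x (by simp) y (by simp)) (.cons (hB _ _ (h x' (by simp) y (by simp))) hz)
      · intro h; simp only [List.length_cons] at h
        have := hz1 (by omega)
        simp at this ⊢; tauto
      · intro h; simp only [List.length_cons] at h
        have := hz2 (by omega)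
        simp at this ⊢; tauto

/-- A balanced complete bipartite relation has a Hamilton path from any `x` on the left. -/
theorem exists_isListPath_of_length_eq {V : Type*} [DecidableEq V] {B : V → V → Prop}
    (hB : ∀ a b, B a b → B b a) {a b : List V} (hl : a.length = b.length)
    (h : ∀ s ∈ a, ∀ t ∈ b, B s t) {x : V} (hx : x ∈ a) :
    ∃ z ∈ b, ∃ l, IsListPath B x z l ∧ ∀ v, l.count v = a.count v + b.count v := by
  have hp := List.perm_cons_erase hx
  have hlen := hp.length_eq
  simp only [List.length_cons] at hlen
  obtain ⟨z, hz, -, hz2⟩ := isListPath_interleave hB x (a.erase x) b (by omega) (by omega)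
    (fun s hs t ht => h s (hp.mem_iff.2 hs) t ht)
  refine ⟨z, hz2 (by omega), _, hz, fun v => ?_⟩
  rw [count_interleave, hp.count_eq]

theorem exists_isListPath_of_length_succ {V : Type*} [DecidableEq V] {B : V → V → Prop}
    (hB : ∀ a b, B a b → B b a) {a b : List V} (hl : a.length = b.length + 1)
    (h : ∀ s ∈ a, ∀ t ∈ b, B s t) :
    ∃ x ∈ a, ∃ z ∈ a, ∃ l, IsListPath B x z l ∧ ∀ v, l.count v = a.count v + b.count v := by
  match a, hl with
  | x :: a, hl =>
    simp only [List.length_cons] at hl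
    obtain ⟨z, hz, hz1, -⟩ := isListPath_interleave hB x a b (by omega) (by omega) h
    exact ⟨x, by simp, z, hz1 (by omega), _, hz, fun v => count_interleave v _ _⟩

/-- Every vertex lies on exactly one of two paths, one in each of the relations `B` and `R`,
and these paths can be joined into one by an edge in either relation. -/
def HasGoodPath {V : Type*} [DecidableEq V] (R B : V → V → Prop) : Prop :=
  ∃ l₁ l₂ : List V, l₁.IsChain B ∧ l₂.IsChain R ∧
    (∀ a ∈ l₁.getLast?, ∀ b ∈ l₂.head?, R a b ∨ B a b) ∧ ∀ v, l₁.count v + l₂.count v = 1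

section

variable {V : Type*} [DecidableEq V] {R B R' B' : V → V → Prop}

theorem HasGoodPath.mono (hR : ∀ a b, R a b → R' a b) (hB : ∀ a b, B a b → B' a b)
    (h : HasGoodPath R B) : HasGoodPath R' B' := by
  obtain ⟨l₁, l₂, h1, h2, h3, h4⟩ := h
  exact ⟨l₁, l₂, h1.imp hB, h2.imp hR,
    fun a ha b hb => (h3 a ha b hb).imp (hR a b) (hB a b), h4⟩

theorem HasGoodPath.swap (hR : ∀ a b, R a b → R b a) (hB : ∀ a b, B a b → B b a)
    (h : HasGoodPath R B) : HasGoodPath B R := by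
  obtain ⟨l₁, l₂, h1, h2, h3, h4⟩ := h
  refine ⟨l₂.reverse, l₁.reverse, List.isChain_reverse.2 (h2.imp hR),
    List.isChain_reverse.2 (h1.imp hB), ?_, ?_⟩
  · intro a ha b hb
    rw [List.getLast?_reverse] at ha
    rw [List.head?_reverse] at hb
    exact (h3 b hb a ha).symm.imp (hB b a) (hR b a)
  · intro v
    rw [List.count_reverse, List.count_reverse, add_comm, h4]

theorem HasGoodPath.of_paths {a b c d : V} {l m : List V} (hl : IsListPath B a b l)
    (hm : IsListPath R c d m) (h : R b c ∨ B b c) (hv : ∀ v, l.count v + m.count v = 1) :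
    HasGoodPath R B := by
  refine ⟨l, m, hl.1, hm.1, ?_, hv⟩
  rw [hl.2.2, hm.2.1]
  rintro _ ⟨⟩ _ ⟨⟩
  exact h

theorem HasGoodPath.of_path {a b : V} {l : List V} (hl : IsListPath B a b l)
    (hv : ∀ v, l.count v = 1) : HasGoodPath R B :=
  ⟨l, [], hl.1, by simp, by simp, by simpa using hv⟩

end

/-- `R` and `B` are symmetric relations covering exactly the pairs of vertices from distinct
classes of `cls`. -/
structure IsBipartiteColouring {V : Type*} (cls : V → Bool) (R B : V → V → Prop) : Prop where
  symm_R : ∀ a b, R a b → R b a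
  symm_B : ∀ a b, B a b → B b a
  cross_R : ∀ a b, R a b → cls a ≠ cls b
  total : ∀ a b, cls a ≠ cls b → R a b ∨ B a b

/-- A partition of the vertices into an `R`-path `P` and two balanced complete bipartite `B`-graphs
with classes `a₁, b₁` and `a₂, b₂`. -/
structure IsConfig {V : Type*} [DecidableEq V] (cls : V → Bool) (R B : V → V → Prop)
    (P a₁ b₁ a₂ b₂ : List V) : Prop where
  path : P = [] ∨ ∃ p q, IsListPath R p q P ∧ cls p = true ∧ cls q = false
  cls_a₁ : ∀ x ∈ a₁, cls x = true
  cls_b₁ : ∀ x ∈ b₁, cls x = false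
  cls_a₂ : ∀ x ∈ a₂, cls x = true
  cls_b₂ : ∀ x ∈ b₂, cls x = false
  length_eq₁ : a₁.length = b₁.length
  length_eq₂ : a₂.length = b₂.length
  rel₁ : ∀ x ∈ a₁, ∀ y ∈ b₁, B x y
  rel₂ : ∀ x ∈ a₂, ∀ y ∈ b₂, B x y
  count : ∀ v, P.count v + a₁.count v + b₁.count v + a₂.count v + b₂.count v = 1

/-- The state of a depth-first search along `R` with stack `P`: the unvisited vertices are `u₁`
and `u₂`, the finished ones `f₁` and `f₂`. -/
structure IsSearchState {V : Type*} [DecidableEq V] (cls : V → Bool) (R B : V → V → Prop)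
    (P u₁ f₁ u₂ f₂ : List V) : Prop where
  chain : P.IsChain R
  cls_u₁ : ∀ x ∈ u₁, cls x = true
  cls_f₁ : ∀ x ∈ f₁, cls x = false
  cls_u₂ : ∀ x ∈ u₂, cls x = false
  cls_f₂ : ∀ x ∈ f₂, cls x = true
  rel₁ : ∀ x ∈ u₁, ∀ y ∈ f₁, B x y
  rel₂ : ∀ x ∈ u₂, ∀ y ∈ f₂, B x y
  count : ∀ v, P.count v + u₁.count v + f₁.count v + u₂.count v + f₂.count v = 1

section

variable {V : Type*} [DecidableEq V] {cls : V → Bool} {R B : V → V → Prop}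
  {P u₁ f₁ u₂ f₂ a₁ b₁ a₂ b₂ : List V}

omit [DecidableEq V] in
theorem IsBipartiteColouring.not_class (h : IsBipartiteColouring cls R B) :
    IsBipartiteColouring (fun v => !cls v) R B where
  symm_R := h.symm_R
  symm_B := h.symm_B
  cross_R a b hab := by simpa using h.cross_R a b hab
  total a b hab := h.total a b (by simpa using hab)

omit [DecidableEq V] in
theorem IsBipartiteColouring.rel_B (h : IsBipartiteColouring cls R B) {a b : V}
    (hab : cls a ≠ cls b) (hR : ¬ R a b) : B a b := (h.total a b hab).resolve_left hR

theorem IsSearchState.not_class (h : IsSearchState cls R B P u₁ f₁ u₂ f₂) :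
    IsSearchState (fun v => !cls v) R B P u₂ f₂ u₁ f₁ where
  chain := h.chain
  cls_u₁ x hx := by simp [h.cls_u₂ x hx]
  cls_f₁ x hx := by simp [h.cls_f₂ x hx]
  cls_u₂ x hx := by simp [h.cls_u₁ x hx]
  cls_f₂ x hx := by simp [h.cls_f₁ x hx]
  rel₁ := h.rel₂
  rel₂ := h.rel₁
  count v := by have := h.count v; omega

theorem IsSearchState.push (h : IsSearchState cls R B P u₁ f₁ u₂ f₂) {x : V} (hx : x ∈ u₁)
    (hP : ∀ y ∈ P.head?, R x y) : IsSearchState cls R B (x :: P) (u₁.erase x) f₁ u₂ f₂ where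
  chain := List.isChain_cons.2 ⟨hP, h.chain⟩
  cls_u₁ y hy := h.cls_u₁ y (List.mem_of_mem_erase hy)
  cls_f₁ := h.cls_f₁
  cls_u₂ := h.cls_u₂
  cls_f₂ := h.cls_f₂
  rel₁ y hy := h.rel₁ y (List.mem_of_mem_erase hy)
  rel₂ := h.rel₂
  count v := by
    have := h.count v
    have h2 := (List.perm_cons_erase hx).count_eq v
    simp only [List.count_cons] at *
    omega

theorem IsSearchState.pop {x : V} (h : IsSearchState cls R B (x :: P) u₁ f₁ u₂ f₂)
    (hx : cls x = false) (hB : ∀ y ∈ u₁, B y x) :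
    IsSearchState cls R B P u₁ (x :: f₁) u₂ f₂ where
  chain := (List.isChain_cons.1 h.chain).2
  cls_u₁ := h.cls_u₁
  cls_f₁ := by simpa [hx] using h.cls_f₁
  cls_u₂ := h.cls_u₂
  cls_f₂ := h.cls_f₂
  rel₁ y hy z hz := by
    rcases List.mem_cons.1 hz with rfl | hz
    exacts [hB y hy, h.rel₁ y hy z hz]
  rel₂ := h.rel₂
  count v := by
    have := h.count v
    simp only [List.count_cons] at *
    omega

theorem IsSearchState.exists_step_of_cons (hc : IsBipartiteColouring cls R B) {x : V}
    (h : IsSearchState cls R B (x :: P) u₁ f₁ u₂ f₂) (hx : cls x = false) :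
    ∃ P' u₁' f₁', IsSearchState cls R B P' u₁' f₁' u₂ f₂ ∧
      u₁'.length + f₁.length + 1 = u₁.length + f₁'.length := by
  by_cases hy : ∃ y ∈ u₁, R y x
  · obtain ⟨y, hy, hR⟩ := hy
    refine ⟨_, _, _, h.push hy (by simpa using hR), ?_⟩
    have := (List.perm_cons_erase hy).length_eq
    simp only [List.length_cons] at this
    omega
  · refine ⟨_, _, _, h.pop hx fun y hyu => ?_, by simp; omega⟩
    refine hc.rel_B ?_ fun hR => hy ⟨y, hyu, hR⟩
    simp [hx, h.cls_u₁ y hyu]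

theorem IsSearchState.exists_step (hc : IsBipartiteColouring cls R B)
    (h : IsSearchState cls R B P u₁ f₁ u₂ f₂)
    (hl : f₁.length + f₂.length < u₁.length + u₂.length) :
    ∃ P' u₁' f₁' u₂' f₂', IsSearchState cls R B P' u₁' f₁' u₂' f₂' ∧
      u₁'.length + u₂'.length + f₁.length + f₂.length + 1 =
        u₁.length + u₂.length + f₁'.length + f₂'.length := by
  match P, h with
  | [], h =>
    by_cases h1 : u₁ = []
    · by_cases h2 : u₂ = []
      · simp [h1, h2] at hl
      · obtain ⟨x, hx⟩ := List.exists_mem_of_ne_nil _ h2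
        have := (List.perm_cons_erase hx).length_eq
        simp only [List.length_cons] at this
        have h' := (h.not_class.push hx (by simp)).not_class
        simp only [Bool.not_not] at h'
        exact ⟨_, _, _, _, _, h', by omega⟩
    · obtain ⟨x, hx⟩ := List.exists_mem_of_ne_nil _ h1
      have := (List.perm_cons_erase hx).length_eq
      simp only [List.length_cons] at this
      exact ⟨_, _, _, _, _, h.push hx (by simp), by omega⟩
  | x :: P, h =>
    cases hx : cls x
    · obtain ⟨P', u', f', h', hl'⟩ := h.exists_step_of_cons hc hx
      exact ⟨_, _, _, _, _, h', by omega⟩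
    · obtain ⟨P', u', f', h', hl'⟩ := h.not_class.exists_step_of_cons hc.not_class (by simp [hx])
      have h'' := h'.not_class
      simp only [Bool.not_not] at h''
      exact ⟨_, _, _, _, _, h'', by omega⟩

theorem IsSearchState.exists_balanced (hc : IsBipartiteColouring cls R B) (n : ℕ)
    (h : IsSearchState cls R B P u₁ f₁ u₂ f₂)
    (hl : u₁.length + u₂.length = f₁.length + f₂.length + n) :
    ∃ P' u₁' f₁' u₂' f₂', IsSearchState cls R B P' u₁' f₁' u₂' f₂' ∧
      u₁'.length + u₂'.length = f₁'.length + f₂'.length := by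
  induction n generalizing P u₁ f₁ u₂ f₂ with
  | zero => exact ⟨_, _, _, _, _, h, hl⟩
  | succ n ih =>
    obtain ⟨P', u₁', f₁', u₂', f₂', h', hl'⟩ := h.exists_step hc (by omega)
    exact ih h' (by omega)

theorem IsConfig.swap (h : IsConfig cls R B P a₁ b₁ a₂ b₂) : IsConfig cls R B P a₂ b₂ a₁ b₁ where
  path := h.path
  cls_a₁ := h.cls_a₂
  cls_b₁ := h.cls_b₂
  cls_a₂ := h.cls_a₁
  cls_b₂ := h.cls_b₁
  length_eq₁ := h.length_eq₂
  length_eq₂ := h.length_eq₁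
  rel₁ := h.rel₂
  rel₂ := h.rel₁
  count v := by have := h.count v; omega

omit [DecidableEq V] in
theorem IsListPath.countP_class {p q : V} (hR : ∀ a b, R a b → cls a ≠ cls b)
    (h : IsListPath R p q P) (hpq : cls p ≠ cls q) :
    P.countP (fun v => cls v) = P.countP (fun v => !cls v) := by
  induction hn : P.length using Nat.strong_induction_on generalizing P p with
  | _ n ih =>
    rcases h.eq_cons with ⟨rfl, h'⟩ | ⟨w, m, rfl, hpw, hm⟩
    · exact absurd rfl hpq
    · rcases hm.eq_cons with ⟨rfl, rfl⟩ | ⟨w', m', rfl, hww, hm'⟩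
      · revert hpq
        simp [List.countP_cons]
        cases cls p <;> cases cls w <;> simp
      · have h1 := hR _ _ hpw
        have h2 := hR _ _ hww
        have := ih _ (by simp [← hn]) hm' (by
          revert h1 h2 hpq
          cases cls p <;> cases cls w <;> cases cls w' <;> cases cls q <;> simp) rfl
        simp only [List.countP_cons]
        revert h1
        cases cls p <;> cases cls w <;> simp <;> omega

theorem countP_eq_card [Fintype V] {l : List V} (hl : ∀ v, l.count v = 1) (p : V → Bool) :
    l.countP p = Fintype.card {v // p v = true} := by
  have hp : l.Perm (Finset.univ : Finset V).toList := by
    rw [List.perm_iff_count]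
    intro v
    rw [hl, List.count_eq_one_of_mem (Finset.nodup_toList _) (by simp)]
  rw [hp.countP_eq, Fintype.card_subtype, List.countP_eq_length_filter, ← Finset.length_toList]
  refine List.Perm.length_eq ?_
  rw [List.perm_ext_iff_of_nodup ((Finset.nodup_toList _).filter _) (Finset.nodup_toList _)]
  simp

theorem IsBipartiteColouring.exists_isConfig [Fintype V] (hc : IsBipartiteColouring cls R B)
    (hcard : Fintype.card {v // cls v = true} = Fintype.card {v // (!cls v) = true}) :
    ∃ P a₁ b₁ a₂ b₂, IsConfig cls R B P a₁ b₁ a₂ b₂ := by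
  have h0 : IsSearchState cls R B [] ((Finset.univ.filter fun v => cls v = true).toList) []
      ((Finset.univ.filter fun v => cls v = false).toList) [] := by
    constructor <;> try simp
    intro v
    rw [List.Nodup.count (Finset.nodup_toList _), List.Nodup.count (Finset.nodup_toList _)]
    cases h : cls v <;> simp [h]
  obtain ⟨P, u₁, f₁, u₂, f₂, h, hl⟩ := h0.exists_balanced hc _ (by
    simp only [List.length_nil, zero_add]; rfl)
  have hcount : ∀ v, (P ++ u₁ ++ f₁ ++ u₂ ++ f₂).count v = 1 := by
    intro v
    simpa [List.count_append, add_assoc] using h.count v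
  have e1 := countP_eq_card hcount cls
  have e2 := countP_eq_card hcount (fun v => !cls v)
  rw [← hcard, ← e1] at e2
  have len (l : List V) : l.length = l.countP cls + l.countP (fun v => !cls v) := by
    rw [List.length_eq_countP_add_countP cls]
    simp
  have u1 : u₁.countP cls = u₁.length := List.countP_eq_length.2 h.cls_u₁
  have f1 : f₁.countP cls = 0 := List.countP_eq_zero.2 (by simpa using h.cls_f₁)
  have u2 : u₂.countP cls = 0 := List.countP_eq_zero.2 (by simpa using h.cls_u₂)
  have f2 : f₂.countP cls = f₂.length := List.countP_eq_length.2 h.cls_f₂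
  have lP := len P
  have lu1 := len u₁
  have lf1 := len f₁
  have lu2 := len u₂
  have lf2 := len f₂
  simp only [List.countP_append] at e1 e2
  have key (P' : List V) (hP' : ∀ v, P'.count v = P.count v)
      (hpath : P' = [] ∨ ∃ p q, IsListPath R p q P' ∧ cls p = true ∧ cls q = false)
      (hP : P.countP cls = P.countP (fun v => !cls v)) :
      ∃ P a₁ b₁ a₂ b₂, IsConfig cls R B P a₁ b₁ a₂ b₂ :=
    ⟨P', u₁, f₁, f₂, u₂, hpath, h.cls_u₁, h.cls_f₁, h.cls_f₂, h.cls_u₂, by omega, by omega,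
      h.rel₁, fun x hx y hy => hc.symm_B _ _ (h.rel₂ y hy x hx), fun v => by
        have := h.count v
        rw [hP']
        omega⟩
  by_cases hP : P = []
  · exact key P (fun _ => rfl) (.inl hP) (by simp [hP])
  · obtain ⟨p, q, hpq⟩ := IsListPath.of_isChain h.chain hP
    have hne : cls p ≠ cls q := by
      rw [Ne, hpq.class_eq_iff hc.cross_R, not_not, Nat.even_iff]
      omega
    have hcnt := hpq.countP_class hc.cross_R hne
    cases hp : cls p
    · refine key P.reverse (by simp) (.inr ⟨q, p, hpq.reverse hc.symm_R, ?_, hp⟩) hcnt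
      simpa [hp] using hne
    · refine key P (fun _ => rfl) (.inr ⟨p, q, hpq, hp, ?_⟩) hcnt
      simpa [hp] using hne

end

section

variable {V : Type*} [DecidableEq V] {cls : V → Bool} {R B : V → V → Prop}
  {P a₁ b₁ a₂ b₂ : List V}

theorem IsConfig.not_class (hc : IsBipartiteColouring cls R B)
    (h : IsConfig cls R B P a₁ b₁ a₂ b₂) :
    IsConfig (fun v => !cls v) R B P.reverse b₁ a₁ b₂ a₂ where
  path := by
    rcases h.path with rfl | ⟨p, q, hP, hp, hq⟩
    · simp
    · exact .inr ⟨q, p, hP.reverse hc.symm_R, by simp [hq], by simp [hp]⟩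
  cls_a₁ x hx := by simp [h.cls_b₁ x hx]
  cls_b₁ x hx := by simp [h.cls_a₁ x hx]
  cls_a₂ x hx := by simp [h.cls_b₂ x hx]
  cls_b₂ x hx := by simp [h.cls_a₂ x hx]
  length_eq₁ := h.length_eq₁.symm
  length_eq₂ := h.length_eq₂.symm
  rel₁ x hx y hy := hc.symm_B _ _ (h.rel₁ y hy x hx)
  rel₂ x hx y hy := hc.symm_B _ _ (h.rel₂ y hy x hx)
  count v := by
    have := h.count v
    rw [List.count_reverse]
    omega

theorem IsConfig.hasGoodPath_of_nil (hc : IsBipartiteColouring cls R B)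
    (h : IsConfig cls R B P a₁ b₁ a₂ b₂) (ha₂ : a₂ = []) : HasGoodPath R B := by
  have hb₂ : b₂ = [] := by
    have := h.length_eq₂
    rw [ha₂] at this
    exact List.eq_nil_of_length_eq_zero this.symm
  have hcount := h.count
  simp only [ha₂, hb₂, List.count_nil, add_zero] at hcount
  by_cases ha : a₁ = []
  · have hb : b₁ = [] := by
      have := h.length_eq₁
      rw [ha] at this
      exact List.eq_nil_of_length_eq_zero this.symm
    simp only [ha, hb, List.count_nil, add_zero] at hcount
    refine ⟨[], P, by simp, ?_, by simp, by simpa using hcount⟩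
    rcases h.path with rfl | ⟨p, q, hP, -⟩
    exacts [by simp, hP.1]
  · obtain ⟨x, hx⟩ := List.exists_mem_of_ne_nil _ ha
    obtain ⟨z, hz, l, hl, hlc⟩ :=
      exists_isListPath_of_length_eq hc.symm_B h.length_eq₁ h.rel₁ hx
    rcases h.path with rfl | ⟨p, q, hP, hp, hq⟩
    · refine .of_path hl fun v => ?_
      have := hcount v
      simp only [List.count_nil] at this
      rw [hlc]
      omega
    · refine .of_paths hl hP (hc.total _ _ (by simp [hp, h.cls_b₁ z hz])) fun v => ?_
      have := hcount v
      rw [hlc]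
      omega

theorem IsConfig.hasGoodPath_of_rel (hc : IsBipartiteColouring cls R B)
    (h : IsConfig cls R B P a₁ b₁ a₂ b₂) {x y : V} (hx : x ∈ a₁) (hy : y ∈ b₂) (hxy : B x y) :
    HasGoodPath R B := by
  obtain ⟨z, hz, l, hl, hlc⟩ := exists_isListPath_of_length_eq hc.symm_B h.length_eq₁ h.rel₁ hx
  obtain ⟨w, hw, m, hm, hmc⟩ := exists_isListPath_of_length_eq hc.symm_B h.length_eq₂.symm
    (fun s hs t ht => hc.symm_B _ _ (h.rel₂ t ht s hs)) hy
  have hlm := (hm.reverse hc.symm_B).append (hc.symm_B _ _ hxy) hl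
  have hcount := h.count
  rcases h.path with rfl | ⟨p, q, hP, hp, hq⟩
  · refine .of_path hlm fun v => ?_
    have := hcount v
    simp only [List.count_nil] at this
    simp only [List.count_append, List.count_reverse, hlc, hmc]
    omega
  · refine .of_paths hlm hP (hc.total _ _ (by simp [hp, h.cls_b₁ z hz])) fun v => ?_
    have := hcount v
    simp only [List.count_append, List.count_reverse, hlc, hmc]
    omega

theorem IsConfig.hasGoodPath_of_head (hc : IsBipartiteColouring cls R B)
    (h : IsConfig cls R B P a₁ b₁ a₂ b₂) {p q y z : V} (hP : IsListPath R p q P)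
    (hp : cls p = true) (hq : cls q = false) (hy : y ∈ b₁) (hz : z ∈ b₂) (hpy : B p y)
    (hpz : B p z) : HasGoodPath R B := by
  rcases hP.eq_cons with ⟨rfl, -⟩ | ⟨p', P', rfl, hpp', hP'⟩
  · simp [hp] at hq
  obtain ⟨s, hs, l, hl, hlc⟩ := exists_isListPath_of_length_eq hc.symm_B h.length_eq₁.symm
    (fun s hs t ht => hc.symm_B _ _ (h.rel₁ t ht s hs)) hy
  obtain ⟨t, ht, m, hm, hmc⟩ := exists_isListPath_of_length_eq hc.symm_B h.length_eq₂.symm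
    (fun s hs t ht => hc.symm_B _ _ (h.rel₂ t ht s hs)) hz
  refine .of_paths ((hl.reverse hc.symm_B).append (hc.symm_B _ _ hpy) (hm.cons hpz)) hP'
    (hc.total _ _ ?_) fun v => ?_
  · have := hc.cross_R _ _ hpp'
    rwa [h.cls_a₂ t ht, ← hp]
  · have := h.count v
    simp only [List.count_append, List.count_reverse, List.count_cons, hlc, hmc] at *
    omega

theorem IsConfig.hasGoodPath_of_last (hc : IsBipartiteColouring cls R B)
    (h : IsConfig cls R B P a₁ b₁ a₂ b₂) {p q y z : V} (hP : IsListPath R p q P)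
    (hp : cls p = true) (hq : cls q = false) (hy : y ∈ a₁) (hz : z ∈ a₂) (hqy : B q y)
    (hqz : B q z) : HasGoodPath R B :=
  (h.not_class hc).hasGoodPath_of_head hc.not_class (hP.reverse hc.symm_R) (by simp [hq])
    (by simp [hp]) hy hz hqy hqz

theorem IsConfig.extend (hc : IsBipartiteColouring cls R B)
    (h : IsConfig cls R B P a₁ b₁ a₂ b₂) {p q x y : V} (hP : IsListPath R p q P)
    (hx : x ∈ a₁) (hy : y ∈ b₁) (hqx : R q x) (hpy : R p y) :
    IsConfig cls R B ((y :: P) ++ [x]).reverse (a₁.erase x) (b₁.erase y) a₂ b₂ where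
  path := .inr ⟨x, y, ((hP.cons (hc.symm_R _ _ hpy)).append hqx (.single x)).reverse hc.symm_R,
    h.cls_a₁ x hx, h.cls_b₁ y hy⟩
  cls_a₁ z hz := h.cls_a₁ z (List.mem_of_mem_erase hz)
  cls_b₁ z hz := h.cls_b₁ z (List.mem_of_mem_erase hz)
  cls_a₂ := h.cls_a₂
  cls_b₂ := h.cls_b₂
  length_eq₁ := by rw [List.length_erase_of_mem hx, List.length_erase_of_mem hy, h.length_eq₁]
  length_eq₂ := h.length_eq₂
  rel₁ z hz w hw := h.rel₁ z (List.mem_of_mem_erase hz) w (List.mem_of_mem_erase hw)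
  rel₂ := h.rel₂
  count v := by
    have := h.count v
    have hxv := (List.perm_cons_erase hx).count_eq v
    have hyv := (List.perm_cons_erase hy).count_eq v
    simp only [List.count_append, List.count_reverse, List.count_cons, List.count_nil] at *
    omega

theorem IsConfig.ends_of_head {N : ℕ} (hc : IsBipartiteColouring cls R B) (hG : ¬ HasGoodPath R B)
    (hN : ∀ P a₁ b₁ a₂ b₂, IsConfig cls R B P a₁ b₁ a₂ b₂ → N ≤ a₁.length + a₂.length)
    (h : IsConfig cls R B P a₁ b₁ a₂ b₂) (hlen : a₁.length + a₂.length = N) {p q : V}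
    (hP : IsListPath R p q P) (hp : cls p = true) (hq : cls q = false)
    (hpb : ∀ y ∈ b₁, ¬ B p y) :
    (∀ y ∈ b₁, ¬ B p y) ∧ (∀ y ∈ b₂, ¬ R p y) ∧ (∀ x ∈ a₂, ¬ B q x) ∧ (∀ x ∈ a₁, ¬ R q x) := by
  have ha₁ : a₁ ≠ [] := fun h0 => hG (h.swap.hasGoodPath_of_nil hc h0)
  have ha₂ : a₂ ≠ [] := fun h0 => hG (h.hasGoodPath_of_nil hc h0)
  have hb₁ : b₁ ≠ [] := by
    rintro rfl
    exact ha₁ (List.eq_nil_of_length_eq_zero h.length_eq₁)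
  obtain ⟨x₁, hx₁⟩ := List.exists_mem_of_ne_nil _ ha₁
  obtain ⟨x₂, hx₂⟩ := List.exists_mem_of_ne_nil _ ha₂
  obtain ⟨y₁, hy₁⟩ := List.exists_mem_of_ne_nil _ hb₁
  have hRy {y : V} (hy : cls y = false) (hpy : ¬ B p y) : R p y :=
    (hc.total p y (by simp [hp, hy])).resolve_right hpy
  have hRx {x : V} (hx : cls x = true) (hqx : ¬ B q x) : R q x :=
    (hc.total q x (by simp [hx, hq])).resolve_right hqx
  have hqa₁ : ∀ x ∈ a₁, ¬ R q x := by
    intro x hx hqx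
    have := hN _ _ _ _ _ (h.extend hc hP hx hy₁ hqx (hRy (h.cls_b₁ _ hy₁) (hpb _ hy₁)))
    rw [List.length_erase_of_mem hx] at this
    have := List.length_pos_of_mem hx
    omega
  have hqa₂ : ∀ x ∈ a₂, ¬ B q x := fun x hx hqx =>
    hG (h.hasGoodPath_of_last hc hP hp hq hx₁ hx
      (hc.rel_B (by simp [hq, h.cls_a₁ _ hx₁]) (hqa₁ _ hx₁)) hqx)
  refine ⟨hpb, ?_, hqa₂, hqa₁⟩
  intro y hy hpy
  have := hN _ _ _ _ _ (h.swap.extend hc hP hx₂ hy (hRx (h.cls_a₂ _ hx₂) (hqa₂ _ hx₂)) hpy)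
  rw [List.length_erase_of_mem hx₂] at this
  have := List.length_pos_of_mem hx₂
  omega

theorem IsConfig.ends {N : ℕ} (hc : IsBipartiteColouring cls R B) (hG : ¬ HasGoodPath R B)
    (hN : ∀ P a₁ b₁ a₂ b₂, IsConfig cls R B P a₁ b₁ a₂ b₂ → N ≤ a₁.length + a₂.length)
    (h : IsConfig cls R B P a₁ b₁ a₂ b₂) (hlen : a₁.length + a₂.length = N) {p q : V}
    (hP : IsListPath R p q P) (hp : cls p = true) (hq : cls q = false) :
    ((∀ y ∈ b₁, ¬ B p y) ∧ (∀ y ∈ b₂, ¬ R p y) ∧ (∀ x ∈ a₂, ¬ B q x) ∧ (∀ x ∈ a₁, ¬ R q x)) ∨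
    ((∀ y ∈ b₂, ¬ B p y) ∧ (∀ y ∈ b₁, ¬ R p y) ∧ (∀ x ∈ a₁, ¬ B q x) ∧ (∀ x ∈ a₂, ¬ R q x)) := by
  by_cases hpb : ∀ y ∈ b₁, ¬ B p y
  · exact .inl (h.ends_of_head hc hG hN hlen hP hp hq hpb)
  · refine .inr (h.swap.ends_of_head hc hG hN (by omega) hP hp hq ?_)
    push Not at hpb
    obtain ⟨y, hy, hpy⟩ := hpb
    exact fun z hz hpz => hG (h.hasGoodPath_of_head hc hP hp hq hy hz hpy hpz)

/-- A partition of the vertices into an `R`-cycle `c :: D` and two almost balanced complete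
bipartite `B`-graphs with classes `a₁, b₁` and `a₂, b₂`. -/
structure IsCycleConfig (cls : V → Bool) (R B : V → V → Prop) (c : V)
    (D a₁ b₁ a₂ b₂ : List V) : Prop where
  closed : (c :: D ++ [c]).IsChain R
  cls_a₁ : ∀ x ∈ a₁, cls x = true
  cls_b₁ : ∀ x ∈ b₁, cls x = false
  cls_a₂ : ∀ x ∈ a₂, cls x = true
  cls_b₂ : ∀ x ∈ b₂, cls x = false
  length_eq₁ : a₁.length = b₁.length + 1
  length_eq₂ : b₂.length = a₂.length + 1
  rel₁ : ∀ x ∈ a₁, ∀ y ∈ b₁, B x y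
  rel₂ : ∀ x ∈ a₂, ∀ y ∈ b₂, B x y
  count : ∀ v, (c :: D).count v + a₁.count v + b₁.count v + a₂.count v + b₂.count v = 1

/-- The vertex `c` is joined by `B` to all vertices of `a` or `b` in the other class. -/
def IsAttached (cls : V → Bool) (B : V → V → Prop) (a b : List V) (c : V) : Prop :=
  (cls c = false → ∀ x ∈ a, B c x) ∧ (cls c = true → ∀ y ∈ b, B c y)

theorem IsCycleConfig.rotate {c d : V} {s t : List V}
    (h : IsCycleConfig cls R B c (s ++ d :: t) a₁ b₁ a₂ b₂) :
    IsCycleConfig cls R B d (t ++ c :: s) a₁ b₁ a₂ b₂ where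
  closed := by
    have := h.closed
    rw [show c :: (s ++ d :: t) ++ [c] = (c :: s) ++ d :: (t ++ [c]) by simp,
      List.isChain_split] at this
    rw [show d :: (t ++ c :: s) ++ [d] = (d :: t) ++ c :: (s ++ [d]) by simp, List.isChain_split]
    exact ⟨this.2, this.1⟩
  cls_a₁ := h.cls_a₁
  cls_b₁ := h.cls_b₁
  cls_a₂ := h.cls_a₂
  cls_b₂ := h.cls_b₂
  length_eq₁ := h.length_eq₁
  length_eq₂ := h.length_eq₂
  rel₁ := h.rel₁
  rel₂ := h.rel₂
  count v := by
    have := h.count v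
    simp only [List.count_append, List.count_cons] at *
    omega

theorem IsCycleConfig.isAttached_fourth {N : ℕ} (hc : IsBipartiteColouring cls R B)
    (hG : ¬ HasGoodPath R B)
    (hN : ∀ P a₁ b₁ a₂ b₂, IsConfig cls R B P a₁ b₁ a₂ b₂ → N ≤ a₁.length + a₂.length)
    {c₀ c₁ c₂ c₃ : V} {D : List V}
    (h : IsCycleConfig cls R B c₀ (c₁ :: c₂ :: c₃ :: D) a₁ b₁ a₂ b₂)
    (hlen : a₁.length + b₂.length = N) (h₀ : IsAttached cls B a₁ b₂ c₀)
    (h₁ : IsAttached cls B a₁ b₂ c₁) (h₂ : IsAttached cls B a₁ b₂ c₂) :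
    IsAttached cls B a₁ b₂ c₃ := by
  have hcl := h.closed
  simp only [List.cons_append, List.isChain_cons_cons] at hcl
  obtain ⟨h01, h12, h23, hcl⟩ := hcl
  have hpath : IsListPath R c₃ c₀ (c₃ :: D ++ [c₀]) :=
    ⟨hcl, by simp, by rw [List.getLast?_append]; simp⟩
  have x01 := hc.cross_R _ _ h01
  have x12 := hc.cross_R _ _ h12
  have x23 := hc.cross_R _ _ h23
  have hl₁ := h.length_eq₁
  have hl₂ := h.length_eq₂
  have hcount := h.count
  obtain ⟨y, hy⟩ : ∃ y, y ∈ b₂ := List.exists_mem_of_length_pos (by omega)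
  obtain ⟨x, hx⟩ : ∃ x, x ∈ a₁ := List.exists_mem_of_length_pos (by omega)
  cases e0 : cls c₀
  · have e1 : cls c₁ = true := by revert x01; simp [e0]
    have e2 : cls c₂ = false := by revert x12; simp [e1]
    have e3 : cls c₃ = true := by revert x23; simp [e2]
    refine ⟨by simp [e3], fun _ => ?_⟩
    have hconf : IsConfig cls R B (c₃ :: D ++ [c₀]) a₁ (c₂ :: b₁) (c₁ :: a₂) b₂ :=
      { path := .inr ⟨_, _, hpath, e3, e0⟩
        cls_a₁ := h.cls_a₁
        cls_b₁ := by simpa [e2] using h.cls_b₁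
        cls_a₂ := by simpa [e1] using h.cls_a₂
        cls_b₂ := h.cls_b₂
        length_eq₁ := by simp [hl₁]
        length_eq₂ := by simp [hl₂]
        rel₁ := fun s hs t ht => by
          rcases List.mem_cons.1 ht with rfl | ht
          exacts [hc.symm_B _ _ (h₂.1 e2 s hs), h.rel₁ s hs t ht]
        rel₂ := fun s hs t ht => by
          rcases List.mem_cons.1 hs with rfl | hs
          exacts [h₁.2 e1 t ht, h.rel₂ s hs t ht]
        count := fun v => by
          have := hcount v
          simp only [List.count_append, List.count_cons, List.count_nil] at *
          omega }
    rcases hconf.ends hc hG hN (by simp; omega) hpath e3 e0 with H | H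
    · exact fun y hy => hc.rel_B (by simp [e3, h.cls_b₂ y hy]) (H.2.1 y hy)
    · exact absurd (h₀.1 e0 x hx) (H.2.2.1 x hx)
  · have e1 : cls c₁ = false := by revert x01; simp [e0]
    have e2 : cls c₂ = true := by revert x12; simp [e1]
    have e3 : cls c₃ = false := by revert x23; simp [e2]
    refine ⟨fun _ => ?_, by simp [e3]⟩
    have hpath' := hpath.reverse hc.symm_R
    have hconf : IsConfig cls R B (c₃ :: D ++ [c₀]).reverse a₁ (c₁ :: b₁) (c₂ :: a₂) b₂ :=
      { path := .inr ⟨_, _, hpath', e0, e3⟩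
        cls_a₁ := h.cls_a₁
        cls_b₁ := by simpa [e1] using h.cls_b₁
        cls_a₂ := by simpa [e2] using h.cls_a₂
        cls_b₂ := h.cls_b₂
        length_eq₁ := by simp [hl₁]
        length_eq₂ := by simp [hl₂]
        rel₁ := fun s hs t ht => by
          rcases List.mem_cons.1 ht with rfl | ht
          exacts [hc.symm_B _ _ (h₁.1 e1 s hs), h.rel₁ s hs t ht]
        rel₂ := fun s hs t ht => by
          rcases List.mem_cons.1 hs with rfl | hs
          exacts [h₂.2 e2 t ht, h.rel₂ s hs t ht]
        count := fun v => by
          have := hcount v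
          simp only [List.count_append, List.count_reverse, List.count_cons, List.count_nil] at *
          omega }
    rcases hconf.ends hc hG hN (by simp; omega) hpath' e0 e3 with H | H
    · exact fun x hx => hc.rel_B (by simp [e3, h.cls_a₁ x hx]) (H.2.2.2 x hx)
    · exact absurd (h₀.2 e0 y hy) (H.1 y hy)

theorem IsCycleConfig.isAttached {N : ℕ} (hc : IsBipartiteColouring cls R B)
    (hG : ¬ HasGoodPath R B)
    (hN : ∀ P a₁ b₁ a₂ b₂, IsConfig cls R B P a₁ b₁ a₂ b₂ → N ≤ a₁.length + a₂.length)
    {c₀ c₁ c₂ : V} {D E : List V}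
    (h : IsCycleConfig cls R B c₀ (c₁ :: c₂ :: (D ++ E)) a₁ b₁ a₂ b₂)
    (hlen : a₁.length + b₂.length = N) (h₀ : IsAttached cls B a₁ b₂ c₀)
    (h₁ : IsAttached cls B a₁ b₂ c₁) (h₂ : IsAttached cls B a₁ b₂ c₂) :
    ∀ c ∈ D, IsAttached cls B a₁ b₂ c := by
  induction D generalizing c₀ c₁ c₂ E with
  | nil => simp
  | cons c₃ D ih =>
    have h₃ := h.isAttached_fourth hc hG hN hlen h₀ h₁ h₂
    have hrot : IsCycleConfig cls R B c₁ (c₂ :: c₃ :: (D ++ (E ++ [c₀]))) a₁ b₁ a₂ b₂ := by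
      simpa using IsCycleConfig.rotate (s := []) h
    intro c hcD
    rcases List.mem_cons.1 hcD with rfl | hcD
    exacts [h₃, ih hrot h₁ h₂ h₃ c hcD]

theorem IsCycleConfig.hasGoodPath_of_chord (hc : IsBipartiteColouring cls R B)
    {u v : V} {D : List V} (h : IsCycleConfig cls R B u D a₁ b₁ a₂ b₂)
    (hatt : ∀ c ∈ u :: D, IsAttached cls B a₁ b₂ c) (hu : cls u = true) (hv : cls v = false)
    (hvD : v ∈ D) (huv : ¬ R u v) : HasGoodPath R B := by
  obtain ⟨x₁, hx₁, x₂, hx₂, lx, hlx, hlxc⟩ :=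
    exists_isListPath_of_length_succ hc.symm_B h.length_eq₁ h.rel₁
  obtain ⟨y₁, hy₁, y₂, hy₂, ly, hly, hlyc⟩ :=
    exists_isListPath_of_length_succ hc.symm_B h.length_eq₂
      (fun s hs t ht => hc.symm_B _ _ (h.rel₂ t ht s hs))
  obtain ⟨L, M, rfl⟩ := List.append_of_mem hvD
  have hcl := h.closed
  rw [show u :: (L ++ v :: M) ++ [u] = (u :: L) ++ v :: (M ++ [u]) by simp,
    List.isChain_split] at hcl
  obtain ⟨hL, hM⟩ := hcl
  obtain ⟨L, w, z, rfl⟩ : ∃ L' w z, L = L' ++ [w, z] := by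
    rcases List.eq_nil_or_concat L with rfl | ⟨L, z, rfl⟩
    · simp [huv] at hL
    rcases List.eq_nil_or_concat L with rfl | ⟨L, w, rfl⟩
    · simp only [List.concat_eq_append, List.nil_append, List.cons_append,
        List.isChain_cons_cons] at hL
      have e1 := hc.cross_R _ _ hL.1
      have e2 := hc.cross_R _ _ hL.2.1
      revert e1 e2
      cases cls z <;> simp [hu, hv]
    · exact ⟨L, w, z, by simp⟩
  obtain ⟨p, q, M, rfl⟩ : ∃ p q M', M = p :: q :: M' := by
    match M, hM with
    | [], hM => exact absurd (hc.symm_R _ _ (by simpa using hM)) huv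
    | [p], hM =>
      simp only [List.cons_append, List.nil_append, List.isChain_cons_cons] at hM
      have e1 := hc.cross_R _ _ hM.1
      have e2 := hc.cross_R _ _ hM.2.1
      revert e1 e2
      cases cls p <;> simp [hu, hv]
    | p :: q :: M, _ => exact ⟨p, q, M, rfl⟩
  rw [show u :: (L ++ [w, z]) ++ [v] = (u :: L) ++ w :: [z, v] by simp,
    List.isChain_split] at hL
  obtain ⟨hL, hwz⟩ := hL
  simp only [List.isChain_cons_cons, List.isChain_singleton, and_true] at hwz
  simp only [List.cons_append, List.isChain_cons_cons] at hM
  obtain ⟨hvp, hpq, hM⟩ := hM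
  have hz : cls z = true := by have := hc.cross_R _ _ hwz.2; simpa [hv] using this
  have hw : cls w = false := by have := hc.cross_R _ _ hwz.1; simpa [hz] using this
  have hp : cls p = true := by have := hc.cross_R _ _ hvp; simpa [hv] using this.symm
  have hq : cls q = false := by have := hc.cross_R _ _ hpq; simpa [hp] using this.symm
  have hX {c : V} (hcD : c ∈ u :: (L ++ [w, z] ++ v :: p :: q :: M)) (hcc : cls c = true) {y : V}
      (hy : y ∈ b₂) : B c y := (hatt c hcD).2 hcc y hy
  have hY {c : V} (hcD : c ∈ u :: (L ++ [w, z] ++ v :: p :: q :: M)) (hcc : cls c = false) {x : V}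
      (hx : x ∈ a₁) : B c x := (hatt c hcD).1 hcc x hx
  have hsym := hc.symm_B
  have hcount := h.count
  by_cases hwp : R w p
  · obtain ⟨e, hMe⟩ : ∃ e, (q :: M).getLast? = some e :=
      ⟨_, List.getLast?_eq_some_getLast (by simp)⟩
    have heu : R e u := by
      rw [show q :: (M ++ [u]) = (q :: M) ++ [u] by simp, List.isChain_append] at hM
      exact hM.2.2 e hMe u (by simp)
    have hchain : (L ++ w :: p :: q :: M).IsChain R := by
      rw [List.isChain_split]
      refine ⟨hL.tail, ?_⟩
      simp only [List.isChain_cons_cons]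
      refine ⟨hwp, hpq, ?_⟩
      rw [show q :: (M ++ [u]) = (q :: M) ++ [u] by simp] at hM
      exact hM.left_of_append
    obtain ⟨s, e', hse⟩ := IsListPath.of_isChain hchain (by simp)
    obtain rfl : e = e' := by
      have := hse.2.2
      rw [show L ++ w :: p :: q :: M = (L ++ [w, p]) ++ (q :: M) by simp,
        List.getLast?_append, hMe] at this
      simpa using this
    have he : cls e = false := by have := hc.cross_R _ _ heu; simpa [hu] using this
    refine .of_paths (IsListPath.cons (hX (by simp) hz hy₁)
      (hly.append (hsym _ _ (hX (by simp) hu hy₂))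
      (.cons (hc.rel_B (by simp [hu, hv]) huv) (.cons (hY (by simp) hv hx₁) hlx))))
      (hse.reverse hc.symm_R) (hc.total _ _ (by simp [he, h.cls_a₁ _ hx₂])) fun a => ?_
    have := hcount a
    simp only [List.count_append, List.count_reverse, List.count_cons, List.count_nil, hlxc,
      hlyc] at *
    omega
  · have hchain : (q :: M ++ u :: L).IsChain R := by
      rw [List.isChain_split]
      exact ⟨hM, hL.left_of_append⟩
    obtain ⟨q', t, hqt⟩ := IsListPath.of_isChain hchain (by simp)
    obtain rfl : q = q' := by simpa using hqt.2.1
    refine .of_paths (IsListPath.cons (hY (by simp) hv hx₁)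
      (hlx.append (hsym _ _ (hY (by simp) hw hx₂))
      (.cons (hc.rel_B (by simp [hw, hp]) hwp) (.cons (hX (by simp) hp hy₁)
      (hly.append (hsym _ _ (hX (by simp) hz hy₂)) (.single z))))))
      hqt (hc.total _ _ (by simp [hz, hq])) fun a => ?_
    have := hcount a
    simp only [List.count_append, List.count_cons, List.count_nil, hlxc, hlyc] at *
    omega

end

/-- The vertices are partitioned into four nonempty lists, with `a`, `l` in one class and `m`, `d`
in the other, such that `a, m` and `l, d` are completely joined by `B`, and `a, d` and `l, m` are
completely joined by `R`. -/
structure IsSplit {V : Type*} [DecidableEq V] (cls : V → Bool) (R B : V → V → Prop)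
    (a l m d : List V) : Prop where
  ne_nil_a : a ≠ []
  ne_nil_l : l ≠ []
  ne_nil_m : m ≠ []
  ne_nil_d : d ≠ []
  cls_m : ∀ x ∈ m, cls x = false
  cls_d : ∀ x ∈ d, cls x = false
  cls_a : ∀ x ∈ a, cls x = true
  cls_l : ∀ x ∈ l, cls x = true
  length_eq : a.length + l.length = m.length + d.length
  rel_am : ∀ x ∈ a, ∀ y ∈ m, B x y
  rel_ld : ∀ x ∈ l, ∀ y ∈ d, B x y
  rel_ad : ∀ x ∈ a, ∀ y ∈ d, R x y
  rel_lm : ∀ x ∈ l, ∀ y ∈ m, R x y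
  count : ∀ v, a.count v + l.count v + m.count v + d.count v = 1

section

variable {V : Type*} [DecidableEq V] {cls : V → Bool} {R B : V → V → Prop}
  {P a₁ b₁ a₂ b₂ : List V}

theorem IsCycleConfig.rel_of_isAttached (hc : IsBipartiteColouring cls R B)
    (hG : ¬ HasGoodPath R B) {c u v : V} {D : List V} (h : IsCycleConfig cls R B c D a₁ b₁ a₂ b₂)
    (hatt : ∀ z ∈ c :: D, IsAttached cls B a₁ b₂ z) (hu : cls u = true) (hv : cls v = false)
    (huD : u ∈ c :: D) (hvD : v ∈ c :: D) : R u v := by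
  have huv : v ≠ u := by
    rintro rfl
    simp [hu] at hv
  by_contra hR
  rcases List.mem_cons.1 huD with rfl | huD
  · exact hG (h.hasGoodPath_of_chord hc hatt hu hv (by simpa [huv] using hvD) hR)
  · obtain ⟨s, t, rfl⟩ := List.append_of_mem huD
    refine hG (h.rotate.hasGoodPath_of_chord hc (fun z hz => hatt z ?_) hu hv ?_ hR)
    · simp at hz ⊢
      tauto
    · simp [huv] at hvD ⊢
      tauto

theorem IsConfig.isCycleConfig (hc : IsBipartiteColouring cls R B)
    (h : IsConfig cls R B P a₁ b₁ a₂ b₂) {p q x y : V} (hP : IsListPath R p q P)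
    (hx : x ∈ a₂) (hy : y ∈ b₁) (hxy : R x y) (hpy : R p y) (hqx : R q x) :
    IsCycleConfig cls R B x (y :: P) a₁ (b₁.erase y) (a₂.erase x) b₂ where
  closed := (((hP.cons (hc.symm_R _ _ hpy)).cons hxy).append hqx (.single x)).1
  cls_a₁ := h.cls_a₁
  cls_b₁ z hz := h.cls_b₁ z (List.mem_of_mem_erase hz)
  cls_a₂ z hz := h.cls_a₂ z (List.mem_of_mem_erase hz)
  cls_b₂ := h.cls_b₂
  length_eq₁ := by
    rw [h.length_eq₁, (List.perm_cons_erase hy).length_eq, List.length_cons]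
  length_eq₂ := by
    rw [← h.length_eq₂, (List.perm_cons_erase hx).length_eq, List.length_cons]
  rel₁ z hz w hw := h.rel₁ z hz w (List.mem_of_mem_erase hw)
  rel₂ z hz w hw := h.rel₂ z (List.mem_of_mem_erase hz) w hw
  count v := by
    have := h.count v
    have hxv := (List.perm_cons_erase hx).count_eq v
    have hyv := (List.perm_cons_erase hy).count_eq v
    simp only [List.count_cons] at *
    omega

theorem IsConfig.rel_R (hc : IsBipartiteColouring cls R B) (hG : ¬ HasGoodPath R B)
    (h : IsConfig cls R B P a₁ b₁ a₂ b₂) {x y : V} (hx : x ∈ a₁) (hy : y ∈ b₂) : R x y :=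
  (hc.total x y (by simp [h.cls_a₁ x hx, h.cls_b₂ y hy])).resolve_right fun hB =>
    hG (h.hasGoodPath_of_rel hc hx hy hB)

theorem IsConfig.ne_nil (hc : IsBipartiteColouring cls R B) (hG : ¬ HasGoodPath R B)
    (h : IsConfig cls R B P a₁ b₁ a₂ b₂) : a₂ ≠ [] ∧ b₂ ≠ [] := by
  have h₂ : a₂ ≠ [] := fun h0 => hG (h.hasGoodPath_of_nil hc h0)
  refine ⟨h₂, ?_⟩
  rintro rfl
  exact h₂ (List.eq_nil_of_length_eq_zero h.length_eq₂)

theorem IsConfig.isSplit_of_nil (hc : IsBipartiteColouring cls R B) (hG : ¬ HasGoodPath R B)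
    (h : IsConfig cls R B [] a₁ b₁ a₂ b₂) : IsSplit cls R B a₁ a₂ b₁ b₂ where
  ne_nil_a := (h.swap.ne_nil hc hG).1
  ne_nil_l := (h.ne_nil hc hG).1
  ne_nil_m := (h.swap.ne_nil hc hG).2
  ne_nil_d := (h.ne_nil hc hG).2
  cls_m := h.cls_b₁
  cls_d := h.cls_b₂
  cls_a := h.cls_a₁
  cls_l := h.cls_a₂
  length_eq := by rw [h.length_eq₁, h.length_eq₂]
  rel_am := h.rel₁
  rel_ld := h.rel₂
  rel_ad _ hx _ hy := h.rel_R hc hG hx hy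
  rel_lm _ hx _ hy := h.swap.rel_R hc hG hx hy
  count v := by
    have := h.count v
    simp only [List.count_nil] at this
    omega

theorem IsConfig.isSplit_of_ends {N : ℕ} (hc : IsBipartiteColouring cls R B)
    (hG : ¬ HasGoodPath R B)
    (hN : ∀ P a₁ b₁ a₂ b₂, IsConfig cls R B P a₁ b₁ a₂ b₂ → N ≤ a₁.length + a₂.length)
    (h : IsConfig cls R B P a₁ b₁ a₂ b₂) (hlen : a₁.length + a₂.length = N) {p q : V}
    (hP : IsListPath R p q P) (hp : cls p = true) (hq : cls q = false)
    (hpb₁ : ∀ y ∈ b₁, ¬ B p y) (hpb₂ : ∀ y ∈ b₂, ¬ R p y) (hqa₂ : ∀ x ∈ a₂, ¬ B q x) :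
    IsSplit cls R B a₁ (P.filter cls ++ a₂) (P.filter (fun v => !cls v) ++ b₁) b₂ := by
  obtain ⟨ha₁, hb₁⟩ := h.swap.ne_nil hc hG
  obtain ⟨ha₂, hb₂⟩ := h.ne_nil hc hG
  obtain ⟨x₀, hx₀⟩ := List.exists_mem_of_ne_nil _ ha₂
  obtain ⟨y₀, hy₀⟩ := List.exists_mem_of_ne_nil _ hb₁
  have hatt (x y : V) (hx : x ∈ a₂) (hy : y ∈ b₁) :
      IsCycleConfig cls R B x (y :: P) a₁ (b₁.erase y) (a₂.erase x) b₂ ∧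
        ∀ c ∈ x :: y :: P, IsAttached cls B a₁ b₂ c := by
    have hcyc := h.isCycleConfig hc hP hx hy (h.swap.rel_R hc hG hx hy)
      ((hc.total p y (by simp [hp, h.cls_b₁ y hy])).resolve_right (hpb₁ y hy))
      ((hc.total q x (by simp [hq, h.cls_a₂ x hx])).resolve_right (hqa₂ x hx))
    refine ⟨hcyc, ?_⟩
    have h0 : IsAttached cls B a₁ b₂ x := ⟨by simp [h.cls_a₂ x hx], fun _ => h.rel₂ x hx⟩
    have h1 : IsAttached cls B a₁ b₂ y :=
      ⟨fun _ z hz => hc.symm_B _ _ (h.rel₁ z hz y hy), by simp [h.cls_b₁ y hy]⟩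
    have h2 : IsAttached cls B a₁ b₂ p :=
      ⟨by simp [hp], fun _ z hz => hc.rel_B (by simp [hp, h.cls_b₂ z hz]) (hpb₂ z hz)⟩
    rcases hP.eq_cons with ⟨rfl, -⟩ | ⟨w, P', rfl, -⟩
    · simp [hp] at hq
    have h3 := IsCycleConfig.isAttached (E := []) hc hG hN (by simpa using hcyc)
      (by rw [← h.length_eq₂, hlen]) h0 h1 h2
    intro c hcm
    simp only [List.mem_cons] at hcm
    rcases hcm with rfl | rfl | rfl | hcm
    exacts [h0, h1, h2, h3 c hcm]
  exact
  { ne_nil_a := ha₁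
    ne_nil_l := by simp [ha₂]
    ne_nil_m := by simp [hb₁]
    ne_nil_d := hb₂
    cls_m := fun x hx => by
      rcases List.mem_append.1 hx with hx | hx
      · simpa using (List.mem_filter.1 hx).2
      · exact h.cls_b₁ x hx
    cls_d := h.cls_b₂
    cls_a := h.cls_a₁
    cls_l := fun x hx => by
      rcases List.mem_append.1 hx with hx | hx
      · simpa using (List.mem_filter.1 hx).2
      · exact h.cls_a₂ x hx
    length_eq := by
      have := hP.countP_class hc.cross_R (by simp [hp, hq])
      simp only [List.countP_eq_length_filter] at this
      rw [List.length_append, List.length_append, h.length_eq₁, h.length_eq₂, this]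
      omega
    rel_am := fun x hx y hy => by
      rcases List.mem_append.1 hy with hy | hy
      · obtain ⟨hyP, hyc⟩ := List.mem_filter.1 hy
        exact hc.symm_B _ _
          (((hatt x₀ y₀ hx₀ hy₀).2 y (by simp [hyP])).1 (by simpa using hyc) x hx)
      · exact h.rel₁ x hx y hy
    rel_ld := fun x hx y hy => by
      rcases List.mem_append.1 hx with hx | hx
      · obtain ⟨hxP, hxc⟩ := List.mem_filter.1 hx
        exact ((hatt x₀ y₀ hx₀ hy₀).2 x (by simp [hxP])).2 hxc y hy
      · exact h.rel₂ x hx y hy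
    rel_ad := fun x hx y hy => h.rel_R hc hG hx hy
    rel_lm := fun u hu v hv => by
      obtain ⟨x, hx, hux, huc⟩ : ∃ x ∈ a₂, u ∈ x :: P ∧ cls u = true := by
        rcases List.mem_append.1 hu with hu | hu
        · obtain ⟨huP, huc⟩ := List.mem_filter.1 hu
          exact ⟨x₀, hx₀, by simp [huP], huc⟩
        · exact ⟨u, hu, by simp, h.cls_a₂ u hu⟩
      obtain ⟨y, hy, hvy, hvc⟩ : ∃ y ∈ b₁, v ∈ y :: P ∧ cls v = false := by
        rcases List.mem_append.1 hv with hv | hv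
        · obtain ⟨hvP, hvc⟩ := List.mem_filter.1 hv
          exact ⟨y₀, hy₀, by simp [hvP], by simpa using hvc⟩
        · exact ⟨v, hv, by simp, h.cls_b₁ v hv⟩
      obtain ⟨hcyc, hall⟩ := hatt x y hx hy
      refine hcyc.rel_of_isAttached hc hG hall huc hvc ?_ (List.mem_cons_of_mem _ hvy)
      simp at hux ⊢
      tauto
    count := fun v => by
      have := h.count v
      have hf : P.count v = (P.filter cls).count v + (P.filter (fun v => !cls v)).count v := by
        rw [← List.count_append]
        exact ((List.filter_append_perm cls P).count_eq v).symm
      simp only [List.count_append]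
      omega }

/-- A two-coloured balanced complete bipartite graph has a good path or a split colouring. -/
theorem IsBipartiteColouring.hasGoodPath_or_isSplit [Fintype V]
    (hc : IsBipartiteColouring cls R B)
    (hcard : Fintype.card {v // cls v = true} = Fintype.card {v // (!cls v) = true}) :
    HasGoodPath R B ∨ ∃ a l m d, IsSplit cls R B a l m d := by
  classical
  by_cases hG : HasGoodPath R B
  · exact .inl hG
  refine .inr ?_
  have hex : ∃ N P a₁ b₁ a₂ b₂, IsConfig cls R B P a₁ b₁ a₂ b₂ ∧
      a₁.length + a₂.length = N := by
    obtain ⟨P, a₁, b₁, a₂, b₂, h⟩ := hc.exists_isConfig hcard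
    exact ⟨_, P, a₁, b₁, a₂, b₂, h, rfl⟩
  obtain ⟨P, a₁, b₁, a₂, b₂, h, hlen⟩ := Nat.find_spec hex
  have hN : ∀ P a₁ b₁ a₂ b₂, IsConfig cls R B P a₁ b₁ a₂ b₂ →
      Nat.find hex ≤ a₁.length + a₂.length :=
    fun P a₁ b₁ a₂ b₂ h => Nat.find_min' hex ⟨P, a₁, b₁, a₂, b₂, h, rfl⟩
  rcases h.path with rfl | ⟨p, q, hP, hp, hq⟩
  · exact ⟨_, _, _, _, h.isSplit_of_nil hc hG⟩
  rcases h.ends hc hG hN hlen hP hp hq with ⟨h1, h2, h3, -⟩ | ⟨h1, h2, h3, -⟩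
  · exact ⟨_, _, _, _, h.isSplit_of_ends hc hG hN hlen hP hp hq h1 h2 h3⟩
  · exact ⟨_, _, _, _, h.swap.isSplit_of_ends hc hG hN (by omega) hP hp hq h1 h2 h3⟩

/-- In a split colouring, an additional `B`-edge inside one of the classes yields a good path. -/
theorem hasGoodPath_of_edge_of_le (hR : ∀ x y, R x y → R y x) (hB : ∀ x y, B x y → B y x)
    {a l m d : List V} {m₀ d₀ : V} (hl : l ≠ [])
    (hlen : a.length + l.length = m.length + d.length) (hle : m.length ≤ a.length)
    (ham : ∀ x ∈ a, ∀ y ∈ m, B x y) (hld : ∀ x ∈ l, ∀ y ∈ d, B x y)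
    (had : ∀ x ∈ a, ∀ y ∈ d, R x y)
    (hcount : ∀ v, a.count v + l.count v + m.count v + d.count v = 1)
    (hm₀ : m₀ ∈ m) (hd₀ : d₀ ∈ d) (hmd : B m₀ d₀) : HasGoodPath R B := by
  have hlpos := List.length_pos_iff.2 hl
  have hdlen := (List.perm_cons_erase hd₀).length_eq
  have hdc := (List.perm_cons_erase hd₀).count_eq
  have hmem {z : V} (hz : z ∈ d.erase d₀) : z ∈ d := List.mem_of_mem_erase hz
  rw [List.length_cons] at hdlen
  set e := d.erase d₀ with he
  set k := l.length - 1 with hk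
  obtain ⟨s, hs, p, hp, hpc⟩ := exists_isListPath_of_length_eq hB
    (a := m) (b := a.take m.length) (by simp; omega)
    (fun s hs t ht => hB _ _ (ham t (List.mem_of_mem_take ht) s hs)) hm₀
  obtain ⟨t, ht, q, hq, hqc⟩ := exists_isListPath_of_length_eq hB
    (a := d₀ :: e.take k) (b := l) (x := d₀) (by simp; omega)
    (fun s hs t ht => hB _ _ (hld t ht s (by
      rcases List.mem_cons.1 hs with rfl | hs
      exacts [hd₀, hmem (List.mem_of_mem_take hs)]))) (by simp)
  have hpq := (hp.reverse hB).append hmd hq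
  have hac (v : V) : a.count v = (a.take m.length).count v + (a.drop m.length).count v := by
    rw [← List.count_append, List.take_append_drop]
  have hec (v : V) : e.count v = (e.take k).count v + (e.drop k).count v := by
    rw [← List.count_append, List.take_append_drop]
  by_cases hnil : e.drop k = []
  · have hnil' : a.drop m.length = [] := by
      rw [List.drop_eq_nil_iff] at hnil ⊢
      omega
    refine .of_path hpq fun v => ?_
    have h1 := hcount v
    have h2 := hdc v
    have h3 := hac v
    have h4 := hec v
    rw [hnil] at h4
    rw [hnil'] at h3
    simp only [List.count_append, List.count_reverse, List.count_cons, List.count_nil, hpc,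
      hqc] at *
    omega
  · obtain ⟨w, hw⟩ := List.exists_mem_of_ne_nil _ hnil
    obtain ⟨z, -, r, hr, hrc⟩ := exists_isListPath_of_length_eq hR
      (a := e.drop k) (b := a.drop m.length) (by simp; omega)
      (fun s hs t ht => hR _ _ (had t (List.mem_of_mem_drop ht) s
        (hmem (List.mem_of_mem_drop hs)))) hw
    refine .of_paths hpq hr (.inr (hld _ ht _ (hmem (List.mem_of_mem_drop hw)))) fun v => ?_
    have h1 := hcount v
    have h2 := hdc v
    have h3 := hac v
    have h4 := hec v
    simp only [List.count_append, List.count_reverse, List.count_cons, hpc, hqc, hrc] at *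
    omega

theorem hasGoodPath_of_edge (hR : ∀ x y, R x y → R y x) (hB : ∀ x y, B x y → B y x)
    {a l m d : List V} {m₀ d₀ : V} (h : IsSplit cls R B a l m d)
    (hm₀ : m₀ ∈ m) (hd₀ : d₀ ∈ d) (hmd : B m₀ d₀) : HasGoodPath R B := by
  have hlen := h.length_eq
  rcases le_total m.length a.length with hle | hle
  · exact hasGoodPath_of_edge_of_le hR hB h.ne_nil_l hlen hle h.rel_am h.rel_ld h.rel_ad h.count
      hm₀ hd₀ hmd
  · exact hasGoodPath_of_edge_of_le hR hB h.ne_nil_a (by omega) (by omega) h.rel_ld h.rel_am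
      h.rel_lm (fun v => by have := h.count v; omega) hd₀ hm₀ (hB _ _ hmd)

theorem IsSplit.swap {a l m d : List V} (h : IsSplit cls R B a l m d) :
    IsSplit cls B R a l d m where
  ne_nil_a := h.ne_nil_a
  ne_nil_l := h.ne_nil_l
  ne_nil_m := h.ne_nil_d
  ne_nil_d := h.ne_nil_m
  cls_m := h.cls_d
  cls_d := h.cls_m
  cls_a := h.cls_a
  cls_l := h.cls_l
  length_eq := by rw [h.length_eq, add_comm]
  rel_am := h.rel_ad
  rel_ld := h.rel_lm
  rel_ad := h.rel_am
  rel_lm := h.rel_ld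
  count v := by have := h.count v; omega

theorem IsSplit.mono {R' B' : V → V → Prop} (hR : ∀ x y, R x y → R' x y)
    (hB : ∀ x y, B x y → B' x y) {a l m d : List V} (h : IsSplit cls R B a l m d) :
    IsSplit cls R' B' a l m d :=
  { h with
    rel_am := fun x hx y hy => hB _ _ (h.rel_am x hx y hy)
    rel_ld := fun x hx y hy => hB _ _ (h.rel_ld x hx y hy)
    rel_ad := fun x hx y hy => hR _ _ (h.rel_ad x hx y hy)
    rel_lm := fun x hx y hy => hR _ _ (h.rel_lm x hx y hy) }

theorem IsSplit.hasGoodPath (hR : ∀ x y, R x y → R y x) (hB : ∀ x y, B x y → B y x)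
    {a l m d : List V} {m₀ d₀ : V} (h : IsSplit cls R B a l m d)
    (hm₀ : m₀ ∈ m) (hd₀ : d₀ ∈ d) (hmd : R m₀ d₀ ∨ B m₀ d₀) : HasGoodPath R B := by
  rcases hmd with hmd | hmd
  · exact (hasGoodPath_of_edge hB hR h.swap hd₀ hm₀ (hR _ _ hmd)).swap hB hR
  · exact hasGoodPath_of_edge hR hB h hm₀ hd₀ hmd

/-- A good path splits into an `R`-path and a `B`-path starting at a common vertex. -/
theorem HasGoodPath.exists_cons [Nonempty V] (hB : ∀ x y, B x y → B y x)
    (h : HasGoodPath R B) :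
    ∃ x s t, (x :: s).IsChain R ∧ (x :: t).IsChain B ∧
      ∀ v, (x :: (s ++ t)).count v = 1 := by
  obtain ⟨l₁, l₂, h1, h2, h3, h4⟩ := h
  have h1' := List.isChain_reverse.2 (h1.imp hB)
  rw [← List.head?_reverse] at h3
  have h4' : ∀ v, l₁.reverse.count v + l₂.count v = 1 := by simpa using h4
  match hm : l₁.reverse, l₂ with
  | [], [] =>
    rw [hm] at h4'
    exact absurd (h4' (Classical.arbitrary V)) (by simp)
  | [], x :: s =>
    rw [hm] at h4'
    exact ⟨x, s, [], h2, by simp, by simpa using h4'⟩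
  | x :: t, [] =>
    rw [hm] at h4' h1'
    exact ⟨x, [], t, by simp, h1', by simpa using h4'⟩
  | x :: t, y :: s =>
    rw [hm] at h4' h1' h3
    rcases h3 x rfl y rfl with hxy | hxy
    · refine ⟨x, y :: s, t, List.isChain_cons_cons.2 ⟨hxy, h2⟩, h1', fun v => ?_⟩
      have := h4' v
      simp only [List.count_append, List.count_cons, List.cons_append] at *
      omega
    · refine ⟨y, s, x :: t, h2, List.isChain_cons_cons.2 ⟨hB _ _ hxy, h1'⟩, fun v => ?_⟩
      have := h4' v
      simp only [List.count_append, List.count_cons] at *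
      omega

end

/-- A nonempty list whose consecutive elements are joined by edges of colour `b` is the support of
a walk with all edges of colour `b`. -/
theorem SimpleGraph.exists_walk_of_isChain {V : Type*} (G : SimpleGraph V) (c : Sym2 V → Bool)
    (b : Bool) {x : V} {s : List V}
    (h : (x :: s).IsChain fun u v => G.Adj u v ∧ c s(u, v) = b) :
    ∃ (u : V) (p : G.Walk x u), p.support = x :: s ∧ ∀ e ∈ p.edges, c e = b := by
  induction s generalizing x with
  | nil => exact ⟨x, .nil, by simp, by simp⟩
  | cons y s ih =>
    rw [List.isChain_cons_cons] at h
    obtain ⟨u, p, hp, hpe⟩ := ih h.2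
    exact ⟨u, .cons h.1.1 p, by simp [hp], by simpa [h.1.2] using hpe⟩

/-- Lemma 2.1: if in a red/blue-coloured complete tripartite graph on `n` vertices with
class sizes `n₁ ≥ n₂ ≥ n₃` one has `n₁ = n/2`, then the graph can be partitioned into a
red path and a blue path sharing exactly one vertex, a common endvertex. -/
theorem stmt6 {V : Type*} [Fintype V]
    (f : V → Fin 3) (hf : Function.Surjective f)
    (G : SimpleGraph V) (hG : ∀ x y, G.Adj x y ↔ f x ≠ f y)
    (c : Sym2 V → Bool)
    (h12 : ({w | f w = 1} : Set V).ncard ≤ ({w | f w = 0} : Set V).ncard)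
    (h23 : ({w | f w = 2} : Set V).ncard ≤ ({w | f w = 1} : Set V).ncard)
    (hhalf : 2 * ({w | f w = 0} : Set V).ncard = Fintype.card V) :
    ∃ (x u v : V) (R : G.Walk u x) (B : G.Walk v x),
      R.IsPath ∧ (∀ e ∈ R.edges, c e = true) ∧
      B.IsPath ∧ (∀ e ∈ B.edges, c e = false) ∧
      {y | y ∈ R.support} ∩ {y | y ∈ B.support} = {x} ∧
      {y | y ∈ R.support} ∪ {y | y ∈ B.support} = Set.univ := by
  classical
  have : Nonempty V := (hf 0).nonempty
  set R' : V → V → Prop := fun u v => G.Adj u v ∧ c s(u, v) = true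
  set B' : V → V → Prop := fun u v => G.Adj u v ∧ c s(u, v) = false
  set cls : V → Bool := fun v => decide (f v = 0) with hcls
  have hsymR : ∀ u v, R' u v → R' v u := fun u v h => ⟨h.1.symm, Sym2.eq_swap ▸ h.2⟩
  have hsymB : ∀ u v, B' u v → B' v u := fun u v h => ⟨h.1.symm, Sym2.eq_swap ▸ h.2⟩
  have htotal : ∀ u v, f u ≠ f v → R' u v ∨ B' u v := fun u v h => by
    cases hcol : c s(u, v)
    exacts [.inr ⟨(hG u v).2 h, hcol⟩, .inl ⟨(hG u v).2 h, hcol⟩]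
  have hcross {u v : V} (h : cls u ≠ cls v) : f u ≠ f v := fun h' => h (by simp [hcls, h'])
  have hc : IsBipartiteColouring cls (fun u v => R' u v ∧ cls u ≠ cls v)
      (fun u v => B' u v ∧ cls u ≠ cls v) :=
    { symm_R := fun u v h => ⟨hsymR u v h.1, h.2.symm⟩
      symm_B := fun u v h => ⟨hsymB u v h.1, h.2.symm⟩
      cross_R := fun u v h => h.2
      total := fun u v h => (htotal u v (hcross h)).imp (⟨·, h⟩) (⟨·, h⟩) }
  have hcard : Fintype.card {v // cls v = true} = Fintype.card {v // (!cls v) = true} := by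
    have h1 : Fintype.card {v // cls v = true} = ({w | f w = 0} : Set V).ncard := by
      rw [← Nat.card_coe_set_eq, Nat.card_eq_fintype_card]
      exact Fintype.card_congr (Equiv.subtypeEquivRight (by simp [hcls]))
    have h2 : Fintype.card {v // (!cls v) = true} = Fintype.card {v // ¬ cls v = true} :=
      Fintype.card_congr (Equiv.subtypeEquivRight (by simp))
    have h3 := Fintype.card_subtype_compl (fun v => cls v = true)
    have h4 := Fintype.card_subtype_le (fun v => cls v = true)
    omega
  have hgood : HasGoodPath R' B' := by
    rcases hc.hasGoodPath_or_isSplit hcard with h | ⟨a, l, m, d, h⟩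
    · exact h.mono (fun _ _ h => h.1) (fun _ _ h => h.1)
    have h' : IsSplit cls R' B' a l m d := h.mono (fun _ _ h => h.1) (fun _ _ h => h.1)
    obtain ⟨m₀, hm₀⟩ := List.exists_mem_of_ne_nil _ h'.ne_nil_m
    obtain ⟨d₀, hd₀⟩ := List.exists_mem_of_ne_nil _ h'.ne_nil_d
    have hmem (v : V) (hv : f v ≠ 0) : v ∈ m ∨ v ∈ d := by
      by_contra! hn
      have h1 : v ∉ a := fun hva => hv (by simpa [hcls] using h'.cls_a v hva)
      have h2 : v ∉ l := fun hvl => hv (by simpa [hcls] using h'.cls_l v hvl)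
      have := h'.count v
      simp [List.count_eq_zero_of_not_mem, h1, h2, hn.1, hn.2] at this
    by_cases hmd : f m₀ = f d₀
    · obtain ⟨i, hi₀, hi⟩ : ∃ i : Fin 3, i ≠ 0 ∧ i ≠ f m₀ := by
        generalize f m₀ = j
        revert j
        decide
      obtain ⟨z, rfl⟩ := hf i
      rcases hmem z hi₀ with hz | hz
      · exact h'.hasGoodPath hsymR hsymB hz hd₀ (htotal _ _ (hmd ▸ hi))
      · exact h'.hasGoodPath hsymR hsymB hm₀ hz (htotal _ _ hi.symm)
    · exact h'.hasGoodPath hsymR hsymB hm₀ hd₀ (htotal _ _ hmd)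
  obtain ⟨x, s, t, hs, ht, hcount⟩ := hgood.exists_cons hsymB
  obtain ⟨u, p, hp, hpe⟩ := G.exists_walk_of_isChain c true hs
  obtain ⟨v, q, hq, hqe⟩ := G.exists_walk_of_isChain c false ht
  have hnodup : (x :: (s ++ t)).Nodup := List.nodup_iff_count_le_one.2 fun v => (hcount v).le
  have hmem (y : V) : y ∈ x :: (s ++ t) := List.count_pos_iff.1 (by rw [hcount y]; exact one_pos)
  simp only [List.nodup_cons, List.mem_append, List.nodup_append, not_or] at hnodup
  obtain ⟨⟨hxs, hxt⟩, hsn, htn, hst⟩ := hnodup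
  refine ⟨x, u, v, p.reverse, q.reverse, ?_, by simpa using hpe, ?_, by simpa using hqe, ?_, ?_⟩
  · rw [SimpleGraph.Walk.isPath_reverse_iff, SimpleGraph.Walk.isPath_def, hp]
    simp [hxs, hsn]
  · rw [SimpleGraph.Walk.isPath_reverse_iff, SimpleGraph.Walk.isPath_def, hq]
    simp [hxt, htn]
  · ext y
    simp only [SimpleGraph.Walk.support_reverse, List.mem_reverse, hp, hq, List.mem_cons,
      Set.mem_inter_iff, Set.mem_ofPred_eq, Set.mem_singleton_iff]
    exact ⟨fun ⟨h1, h2⟩ => h1.elim id fun h1 => h2.elim id fun h2 => absurd rfl (hst y h1 y h2),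
      fun h => ⟨.inl h, .inl h⟩⟩
  · ext y
    have := hmem y
    simp only [SimpleGraph.Walk.support_reverse, List.mem_reverse, hp, hq, List.mem_cons,
      Set.mem_union, Set.mem_ofPred_eq, Set.mem_univ, iff_true, List.mem_append] at this ⊢
    tauto
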